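/- arXiv:2506.16086 — 2 statements merged into one kernel-verified Lean document; each statement's English description precedes it below -/
import Mathlib

section
/- Let T := {r̄ − s̄ − 1̄, r̄ − s̄, r̄ − s̄ + 1̄} ⊆ ℤ/nℤ. There exists a nonempty subset K ⊆ I = (ℤ/nℤ) \ {0̄, r̄} whose image under translation by s̄ equals K and with K ∩ T = ∅, if and only if gcd(r, s) ≥ 4. Equivalently, the largest such subset is empty if and only if gcd(r, s) ≤ 3. -/
/-- A set equal to its image under translation by `s` is stable under translation by every
integer multiple of `s`. -/
theorem add_intCast_mul_mem_of_image_add_eq {R : Type*} [Ring R] {s : R} {K : Set R}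
    (hK : (fun l => l + s) '' K = K) {l : R} (hl : l ∈ K) (k : ℤ) : l + k * s ∈ K := by
  induction k with
  | zero => simpa using hl
  | succ k ih =>
    rw [← hK]
    refine ⟨_, ih, ?_⟩
    push_cast
    noncomm_ring
  | pred k ih =>
    rw [← hK] at ih
    obtain ⟨x, hx, hxe⟩ := ih
    have hxe' : x + s = l + ((-(k : ℤ) : ℤ) : R) * s := hxe
    have hx' : l + ((-(k : ℤ) - 1 : ℤ) : R) * s = x := by
      rw [eq_sub_of_add_eq hxe']
      push_cast
      noncomm_ring
    rwa [hx']

theorem natCast_eq_neg_natCast_zmod_add (r s : ℕ) : (r : ZMod (r + s)) = -(s : ZMod (r + s)) := by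
  rw [eq_neg_iff_add_eq_zero]
  exact_mod_cast ZMod.natCast_self (r + s)

theorem exists_intCast_gcd_eq_mul_zmod_add (r s : ℕ) :
    ∃ b : ℤ, ((Nat.gcd r s : ℕ) : ZMod (r + s)) = b * s := by
  refine ⟨Nat.gcdB r s - Nat.gcdA r s, ?_⟩
  have h := congrArg (Int.cast : ℤ → ZMod (r + s)) (Nat.gcd_eq_gcd_ab r s)
  push_cast at h ⊢
  rw [h, natCast_eq_neg_natCast_zmod_add]
  ring

/-- If a nonempty subset of `ZMod (r + s)` stable under translation by `s` avoids
`{r - s - 1, r - s, r - s + 1}`, then `4 ≤ gcd r s`. -/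
theorem four_le_gcd_of_translation_stable {r s : ℕ} (hr : 1 ≤ r) {K : Set (ZMod (r + s))}
    (hne : K.Nonempty) (hK : (fun l => l + (s : ZMod (r + s))) '' K = K)
    (hT : K ∩ {(r : ZMod (r + s)) - (s : ZMod (r + s)) - 1,
      (r : ZMod (r + s)) - (s : ZMod (r + s)),
      (r : ZMod (r + s)) - (s : ZMod (r + s)) + 1} = ∅) :
    4 ≤ Nat.gcd r s := by
  by_contra! hlt
  have hpos : 0 < Nat.gcd r s := Nat.gcd_pos_of_pos_left s hr
  obtain ⟨l, hl⟩ := hne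
  obtain ⟨z, rfl⟩ := ZMod.intCast_surjective l
  obtain ⟨b, hb⟩ := exists_intCast_gcd_eq_mul_zmod_add r s
  obtain ⟨e, q, he, hq⟩ : ∃ e q : ℤ, (e = -1 ∨ e = 0 ∨ e = 1) ∧ z = e + q * Nat.gcd r s := by
    generalize Nat.gcd r s = d at hlt hpos
    interval_cases d
    · exact ⟨0, z, by simp, by simp⟩
    · exact ⟨z % 2, z / 2, by lia, by push_cast; lia⟩
    · exact ⟨(z + 1) % 3 - 1, (z + 1) / 3, by lia, by push_cast; lia⟩
  have hmem := add_intCast_mul_mem_of_image_add_eq hK hl (-2 - q * b)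
  have heq : (z : ZMod (r + s)) + ((-2 - q * b : ℤ) : ZMod (r + s)) * s = r - s + e := by
    rw [hq, natCast_eq_neg_natCast_zmod_add]
    push_cast
    rw [hb]
    ring
  rw [heq] at hmem
  refine Set.eq_empty_iff_forall_notMem.1 hT _ ⟨hmem, ?_⟩
  rcases he with rfl | rfl | rfl <;> simp [sub_eq_add_neg]

/-- If `4 ≤ gcd r s`, the residues congruent to `2` modulo `gcd r s` form a nonempty subset
stable under translation by `s` that avoids `0`, `r` and `r - s + {-1, 0, 1}`. -/
theorem exists_translation_stable_of_four_le_gcd {r s : ℕ} (h : 4 ≤ Nat.gcd r s) :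
    ∃ K : Set (ZMod (r + s)), K.Nonempty ∧ K ⊆ {l | l ≠ 0 ∧ l ≠ (r : ZMod (r + s))} ∧
      (fun l => l + (s : ZMod (r + s))) '' K = K ∧
      K ∩ {(r : ZMod (r + s)) - (s : ZMod (r + s)) - 1,
        (r : ZMod (r + s)) - (s : ZMod (r + s)),
        (r : ZMod (r + s)) - (s : ZMod (r + s)) + 1} = ∅ := by
  have hdvd : Nat.gcd r s ∣ r + s := dvd_add (Nat.gcd_dvd_left r s) (Nat.gcd_dvd_right r s)
  have hr0 : (r : ZMod (Nat.gcd r s)) = 0 :=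
    (ZMod.natCast_eq_zero_iff _ _).2 (Nat.gcd_dvd_left r s)
  have hs0 : (s : ZMod (Nat.gcd r s)) = 0 :=
    (ZMod.natCast_eq_zero_iff _ _).2 (Nat.gcd_dvd_right r s)
  have hne (m : ℕ) (hm : 0 < m) (hm4 : m < 4) : (m : ZMod (Nat.gcd r s)) ≠ 0 := fun h0 =>
    absurd (Nat.le_of_dvd hm ((ZMod.natCast_eq_zero_iff _ _).1 h0)) (by lia)
  have h1 : (1 : ZMod (Nat.gcd r s)) ≠ 0 := by simpa using hne 1 (by simp) (by simp)
  have h2 : (2 : ZMod (Nat.gcd r s)) ≠ 0 := by simpa using hne 2 (by simp) (by simp)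
  have h3 : (3 : ZMod (Nat.gcd r s)) ≠ 0 := by simpa using hne 3 (by simp) (by simp)
  let f := ZMod.castHom hdvd (ZMod (Nat.gcd r s))
  have hfr : f r = 0 := by rw [map_natCast, hr0]
  have hfs : f s = 0 := by rw [map_natCast, hs0]
  refine ⟨{l | f l = 2}, ⟨2, map_ofNat f 2⟩, ?_, ?_, ?_⟩
  · intro l (hl : f l = 2)
    constructor
    · rintro rfl
      exact h2 (by rw [← hl, map_zero])
    · rintro rfl
      exact h2 (by rw [← hl, hfr])
  · ext l
    constructor
    · rintro ⟨x, hx : f x = 2, rfl⟩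
      simp [hx, hfs]
    · intro (hl : f l = 2)
      exact ⟨l - s, by simp [hl, hfs], by simp⟩
  · rw [Set.eq_empty_iff_forall_notMem]
    rintro l ⟨hl : f l = 2, rfl | rfl | rfl⟩
    · rw [map_sub, map_sub, hfr, hfs, map_one] at hl
      exact h3 (by linear_combination -hl)
    · rw [map_sub, hfr, hfs] at hl
      exact h2 (by linear_combination -hl)
    · rw [map_add, map_sub, hfr, hfs, map_one] at hl
      exact h1 (by linear_combination -hl)

/-- Corollary of §5.2.1 of the paper: there is a nonempty subset of
`I = (ℤ/nℤ) \ {0, r}` stable under `l ↦ l + s` and disjoint from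
`T = {r-s-1, r-s, r-s+1}` iff `gcd(r,s) ≥ 4`; equivalently, the largest such subset
is empty iff `gcd(r,s) ≤ 3`. -/
theorem gln_canonical_parabolic_of_length_one_is_borel_iff (r s : ℕ)
    (hr : 1 ≤ r) (hs : 1 ≤ s) :
    let n : ℕ := r + s
    let I : Set (ZMod n) := {l | l ≠ 0 ∧ l ≠ (r : ZMod n)}
    let T : Set (ZMod n) :=
      {(r : ZMod n) - (s : ZMod n) - 1, (r : ZMod n) - (s : ZMod n),
        (r : ZMod n) - (s : ZMod n) + 1}
    ((∃ K : Set (ZMod n), K.Nonempty ∧ K ⊆ I ∧ (fun l => l + (s : ZMod n)) '' K = K ∧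
        K ∩ T = ∅) ↔ 4 ≤ Nat.gcd r s) ∧
    ((⋃₀ {K : Set (ZMod n) | K ⊆ I ∧ (fun l => l + (s : ZMod n)) '' K = K ∧ K ∩ T = ∅}
        = ∅) ↔ Nat.gcd r s ≤ 3) := by
  intro n I T
  have key : (∃ K : Set (ZMod n), K.Nonempty ∧ K ⊆ I ∧ (fun l => l + (s : ZMod n)) '' K = K ∧
      K ∩ T = ∅) ↔ 4 ≤ Nat.gcd r s :=
    ⟨fun ⟨_, hne, _, hK, hT⟩ => four_le_gcd_of_translation_stable hr hne hK hT,
      exists_translation_stable_of_four_le_gcd⟩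
  refine ⟨key, ?_⟩
  rw [← not_iff_not, not_le, ← Nat.succ_le_iff, ← key, ← ne_eq, ← Set.nonempty_iff_ne_empty,
    Set.nonempty_sUnion]
  exact ⟨fun ⟨K, hK, hne⟩ => ⟨K, hne, hK⟩, fun ⟨K, hne, hK⟩ => ⟨K, hK, hne⟩⟩
end

section
/- Fix j ∈ ℤ/dℤ with 1 ≤ r_j ≤ n − 1. For i ∈ ℤ/dℤ let h_i ∈ {0, …, d−1} be the representative of i − j − 1 modulo d and u_i := T_i(h_i) (with u_i := 0 when h_i = 0). Define C'_i := {x ∈ C_i : x − ū_i − 1̄ ∉ H and x − ū_i + 1̄ ∉ H}, where C_i is as in the computation of the largest stable family. Then: (a) C'_i ⊆ I_i for every i; (b) C'_i = {x + s̄_{i−1} : x ∈ C'_{i−1}} for every i; (c) C'_j ∩ {r̄_j − 1̄, r̄_j, r̄_j + 1̄} = ∅; and (d) for every family (K_i)_{i ∈ ℤ/dℤ} with K_i ⊆ I_i, K_i = {x + s̄_{i−1} : x ∈ K_{i−1}} for all i, and K_j ∩ {r̄_j − 1̄, r̄_j, r̄_j + 1̄} = ∅, one has K_i ⊆ C'_i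 for all i. -/
open Finset in
/-- The integers `0, …, d - 1` represent each class modulo `d` once. -/
lemma ZMod.sum_range_natCast {M : Type*} [AddCommMonoid M] (d : ℕ) [NeZero d]
    (f : ZMod d → M) : ∑ l ∈ range d, f (l : ZMod d) = ∑ x, f x := by
  refine sum_bij' (fun l _ => (l : ZMod d)) (fun x _ => x.val) ?_ ?_ ?_ ?_ ?_
  · simp
  · simp [ZMod.val_lt]
  · intro l hl
    exact ZMod.val_cast_of_lt (mem_range.1 hl)
  · simp
  · simp

open Finset in
lemma ZMod.sum_Icc_sub_natCast {M : Type*} [AddCommMonoid M] (d : ℕ) [NeZero d]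
    (f : ZMod d → M) (i : ZMod d) :
    ∑ l ∈ Icc 1 d, f (i - (l : ZMod d)) = ∑ l ∈ range d, f (l : ZMod d) := by
  rw [ZMod.sum_range_natCast, ← Ico_add_one_right_eq_Icc, sum_Ico_eq_sum_range]
  have h := ZMod.sum_range_natCast d fun x => f (i - (1 + x))
  simp only [Nat.add_sub_cancel, Nat.cast_add, Nat.cast_one]
  rw [h]
  exact Fintype.sum_equiv ((Equiv.addLeft 1).trans (Equiv.subLeft i)) _ _ fun _ => rfl

open Finset in
lemma ZMod.sum_Icc_sub_natCast_succ {M : Type*} [AddCommMonoid M] {d : ℕ}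
    (f : ZMod d → M) (i : ZMod d) (N : ℕ) :
    ∑ l ∈ Icc 1 (N + 1), f (i - (l : ZMod d)) =
      f (i - 1) + ∑ l ∈ Icc 1 N, f (i - 1 - (l : ZMod d)) := by
  simp only [← Ico_add_one_right_eq_Icc, sum_Ico_eq_sum_range, Nat.add_sub_cancel]
  rw [sum_range_succ', add_comm]
  congr 1
  · simp
  · refine sum_congr rfl fun l _ => congrArg f ?_
    push_cast
    ring

lemma ZMod.val_sub_one_add_one {d : ℕ} [NeZero d] {a : ZMod d} (ha : a ≠ 0) :
    (a - 1).val + 1 = a.val := by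
  have hpos : 0 < a.val := Nat.pos_of_ne_zero ((ZMod.val_ne_zero a).2 ha)
  have h : a - 1 = ((a.val - 1 : ℕ) : ZMod d) := by
    rw [Nat.cast_sub hpos, ZMod.natCast_zmod_val, Nat.cast_one]
  rw [h, ZMod.val_cast_of_lt (by have := a.val_lt; omega)]
  omega

lemma ZMod.val_neg_one_add_one (d : ℕ) [NeZero d] : (-1 : ZMod d).val + 1 = d := by
  obtain ⟨k, rfl⟩ := Nat.exists_eq_succ_of_ne_zero (NeZero.ne d)
  rw [ZMod.val_neg_one]

lemma ZMod.zmultiples_natCast_gcd (S n : ℕ) :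
    AddSubgroup.zmultiples ((Nat.gcd S n : ℕ) : ZMod n) =
      AddSubgroup.zmultiples (S : ZMod n) := by
  refine le_antisymm ?_ ?_ <;>
    rw [AddSubgroup.zmultiples_le, AddSubgroup.mem_zmultiples_iff]
  · refine ⟨Nat.gcdA S n, ?_⟩
    have h := congrArg (Int.cast : ℤ → ZMod n) (Nat.gcd_eq_gcd_ab S n)
    push_cast at h
    rw [h, zsmul_eq_mul, ZMod.natCast_self]
    ring
  · obtain ⟨c, hc⟩ := Nat.gcd_dvd_left S n
    refine ⟨c, ?_⟩
    conv_rhs => rw [hc]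
    push_cast
    rw [zsmul_eq_mul, Int.cast_natCast, mul_comm]

/-- In a finite group, a set stable under subtracting `g` is stable under subtracting any
multiple of `g`. -/
lemma AddSubgroup.sub_mem_of_mem_zmultiples {G : Type*} [AddCommGroup G] [Finite G] {g : G}
    {K : Set G} (hK : ∀ x ∈ K, x - g ∈ K) {x h : G} (hx : x ∈ K)
    (hh : h ∈ AddSubgroup.zmultiples g) : x - h ∈ K := by
  obtain ⟨k, rfl⟩ := mem_multiples_iff_mem_zmultiples.2 hh
  induction k with
  | zero => simpa using hx
  | succ k ih =>
    have h := hK _ (ih (AddSubgroup.nsmul_mem_zmultiples g k))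
    simpa [succ_nsmul, sub_sub] using h

/-- Iterating `K i = K (i - 1) + s (i - 1)`. -/
lemma ZMod.sub_sum_mem_of_eq_image {d : ℕ} {G : Type*} [AddCommGroup G] {a : ZMod d → G}
    {K : ZMod d → Set G} (hK : ∀ i, K i = (fun x => x + a (i - 1)) '' K (i - 1)) (N : ℕ) :
    ∀ {i : ZMod d} {x : G}, x ∈ K i →
      x - ∑ l ∈ Finset.Icc 1 N, a (i - (l : ZMod d)) ∈ K (i - (N : ZMod d)) := by
  induction N with
  | zero => simp
  | succ N ih =>
    intro i x hx
    rw [hK i] at hx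
    obtain ⟨y, hy, rfl⟩ := hx
    rw [ZMod.sum_Icc_sub_natCast_succ]
    have h : i - ((N + 1 : ℕ) : ZMod d) = i - 1 - (N : ZMod d) := by
      push_cast
      ring
    simpa only [h, ← sub_sub, add_sub_cancel_right] using ih hy


/-- Proposition `prop-canon1`: for the Weil restriction of `GL_n` along `𝔽_{p^d}/𝔽_p`
and a factor `j` with `1 ≤ r_j ≤ n - 1`, the family
`C'_i = {x ∈ C_i : x - u_i ∓ 1 ∉ H}` is the largest family of subsets `K_i ⊆ I_i` with
`K_i = K_{i-1} + s_{i-1}` for all `i` and `K_j ∩ {r_j - 1, r_j, r_j + 1} = ∅`. -/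
theorem weil_restriction_type_of_canonical_parabolic_of_length_one
    (d n : ℕ) (hd : 1 ≤ d) (hn : 1 ≤ n) (s : ZMod d → ℕ) (hs : ∀ i, s i ≤ n)
    (j : ZMod d) (hj1 : 1 ≤ n - s j) (hj2 : n - s j ≤ n - 1) :
    let S : ℕ := ∑ l ∈ Finset.range d, s (l : ZMod d)
    let H : AddSubgroup (ZMod n) := AddSubgroup.zmultiples ((Nat.gcd S n : ℕ) : ZMod n)
    let T : ZMod d → ℕ → ℕ := fun i N => ∑ l ∈ Finset.Icc 1 N, s (i - (l : ZMod d))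
    let I : ZMod d → Set (ZMod n) := fun i => {x | x ≠ 0 ∧ x ≠ ((n - s i : ℕ) : ZMod n)}
    let C : ZMod d → Set (ZMod n) :=
      fun i => {x | ∀ N : ℕ, 1 ≤ N → N ≤ d → x - ((T i N : ℕ) : ZMod n) ∉ H}
    let u : ZMod d → ℕ := fun i => T i ((i - j - 1).val)
    let C' : ZMod d → Set (ZMod n) :=
      fun i => {x | x ∈ C i ∧ x - ((u i : ℕ) : ZMod n) - 1 ∉ H ∧
        x - ((u i : ℕ) : ZMod n) + 1 ∉ H}
    let Tj : Set (ZMod n) :=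
      {((n - s j : ℕ) : ZMod n) - 1, ((n - s j : ℕ) : ZMod n), ((n - s j : ℕ) : ZMod n) + 1}
    (∀ i, C' i ⊆ I i) ∧
    (∀ i, C' i = (fun x => x + ((s (i - 1) : ℕ) : ZMod n)) '' C' (i - 1)) ∧
    (C' j ∩ Tj = ∅) ∧
    (∀ Kf : ZMod d → Set (ZMod n),
      (∀ i, Kf i ⊆ I i) →
      (∀ i, Kf i = (fun x => x + ((s (i - 1) : ℕ) : ZMod n)) '' Kf (i - 1)) →
      Kf j ∩ Tj = ∅ →
      ∀ i, Kf i ⊆ C' i) := by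
  intro S H T I C u C' Tj
  have : NeZero d := ⟨by omega⟩
  have : NeZero n := ⟨by omega⟩
  have hH : H = AddSubgroup.zmultiples (S : ZMod n) := ZMod.zmultiples_natCast_gcd S n
  have hSH : (S : ZMod n) ∈ H := hH ▸ AddSubgroup.mem_zmultiples _
  have hTd (i : ZMod d) : T i d = S := ZMod.sum_Icc_sub_natCast d s i
  have hTs (i : ZMod d) (N : ℕ) : T i (N + 1) = s (i - 1) + T (i - 1) N :=
    ZMod.sum_Icc_sub_natCast_succ s i N
  have hT0 (i : ZMod d) : T i 0 = 0 := rfl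
  have hr (i : ZMod d) : ((n - s i : ℕ) : ZMod n) = -(s i : ZMod n) := by
    rw [Nat.cast_sub (hs i), ZMod.natCast_self, zero_sub]
  have huj : u (j + 1) = 0 := by simp [u, hT0]
  have hu (i : ZMod d) : ((s (i - 1) : ZMod n) + u (i - 1)) - u i ∈ H := by
    by_cases hi : i - j - 1 = 0
    · have e : i = j + 1 := by linear_combination hi
      have h1 : (j + 1 - 1 - j - 1 : ZMod d) = -1 := by ring
      have h2 : s (i - 1) + u (i - 1) = S := by
        have h3 := hTs (j + 1) (-1 : ZMod d).val
        rw [ZMod.val_neg_one_add_one, hTd] at h3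
        rw [h3, e]
        simp only [u, h1]
      rw [← Nat.cast_add, h2, e, huj]
      simpa using hSH
    · have h1 : u i = s (i - 1) + u (i - 1) := by
        simp only [u]
        rw [← ZMod.val_sub_one_add_one hi, hTs]
        congr 3
        ring
      rw [h1, Nat.cast_add, sub_self]
      exact H.zero_mem
  have hC (i : ZMod d) (x : ZMod n) : x + s (i - 1) ∈ C i ↔ x ∈ C (i - 1) := by
    have h0 : x - S ∈ H ↔ x ∈ H := by
      rw [sub_eq_add_neg, H.add_mem_cancel_right (H.neg_mem hSH)]
    constructor
    · intro hx N h1 h2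
      rcases h2.eq_or_lt with rfl | h2
      · have h := hx 1 le_rfl h1
        rw [← zero_add 1, hTs, hT0] at h
        rw [hTd, h0]
        simpa using h
      · have h := hx (N + 1) (by omega) h2
        rwa [hTs, Nat.cast_add, add_comm x, add_sub_add_left_eq_sub] at h
    · intro hx N h1 h2
      obtain ⟨M, rfl⟩ := Nat.exists_eq_add_of_le' h1
      rw [hTs, Nat.cast_add, add_comm x, add_sub_add_left_eq_sub]
      rcases M.eq_zero_or_pos with rfl | hM
      · have h := hx d hd le_rfl
        rw [hTd, h0] at h
        simpa [hT0] using h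
      · exact hx M hM (by omega)
  have hC' (i : ZMod d) (x : ZMod n) : x + s (i - 1) ∈ C' i ↔ x ∈ C' (i - 1) := by
    refine and_congr (hC i x) (and_congr (not_congr ?_) (not_congr ?_))
    · refine Iff.trans ?_ (H.add_mem_cancel_right (hu i))
      convert Iff.rfl using 2
      ring
    · refine Iff.trans ?_ (H.add_mem_cancel_right (hu i))
      convert Iff.rfl using 2
      ring
  have hCd (i : ZMod d) {x : ZMod n} (hx : x ∈ C' i) : x ≠ 0 := by
    rintro rfl
    apply hx.1 d hd le_rfl
    rw [hTd, zero_sub]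
    exact H.neg_mem hSH
  have hCs (i : ZMod d) {x : ZMod n} (hx : x ∈ C' i) : x + s i ∈ C' (i + 1) := by
    have h := hC' (i + 1) x
    rw [add_sub_cancel_right] at h
    exact h.2 hx
  have hCI (i : ZMod d) : C' i ⊆ I i := fun x hx =>
    ⟨hCd i hx, fun e => hCd (i + 1) (hCs i hx) (by rw [e, hr, neg_add_cancel])⟩
  refine ⟨hCI, fun i => ?_, ?_, fun K hKI hK hKj i x hx => ?_⟩
  · ext x
    constructor
    · intro hx
      refine ⟨x - s (i - 1), (hC' i _).1 ?_, sub_add_cancel _ _⟩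
      rwa [sub_add_cancel]
    · rintro ⟨y, hy, rfl⟩
      exact (hC' i y).2 hy
  · rw [Set.eq_empty_iff_forall_notMem]
    rintro x ⟨hx, hxT⟩
    have h := hCs j hx
    rcases hxT with e | e | e
    · apply h.2.2
      rw [e, hr, huj]
      convert H.zero_mem using 1
      push_cast
      ring
    · exact (hCI j hx).2 e
    · apply h.2.1
      rw [e, hr, huj]
      convert H.zero_mem using 1
      push_cast
      ring
  · have hKT (i : ZMod d) (N : ℕ) {x : ZMod n} (hx : x ∈ K i) :
        x - (T i N : ZMod n) ∈ K (i - (N : ZMod d)) := by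
      have h := ZMod.sub_sum_mem_of_eq_image (a := fun i => (s i : ZMod n)) hK N hx
      simpa [T] using h
    have hKH (i : ZMod d) {x h : ZMod n} (hx : x ∈ K i) (hh : h ∈ H) : x - h ∈ K i := by
      refine AddSubgroup.sub_mem_of_mem_zmultiples (fun y hy => ?_) hx (hH ▸ hh)
      simpa [hTd] using hKT i d hy
    have hK1 {y : ZMod n} (hy : y ∈ K (j + 1)) : y - s j ∈ K j := by
      simpa [hTs, hT0] using hKT (j + 1) 1 hy
    have hKu : x - (u i : ZMod n) ∈ K (j + 1) := by
      have h := hKT i (i - j - 1).val hx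
      rw [ZMod.natCast_zmod_val] at h
      convert h using 2
      ring
    refine ⟨fun N _ _ hN => ?_, fun h => ?_, fun h => ?_⟩
    · have h := hKH _ (hKT i N hx) hN
      rw [sub_self] at h
      exact (hKI _ h).1 rfl
    · refine Set.eq_empty_iff_forall_notMem.1 hKj _ ⟨hK1 (hKH _ hKu h), Or.inr (Or.inr ?_)⟩
      rw [Set.mem_singleton_iff, hr]
      ring
    · refine Set.eq_empty_iff_forall_notMem.1 hKj _ ⟨hK1 (hKH _ hKu h), Or.inl ?_⟩
      rw [hr]
      ring
end
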